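/- arXiv:2508.01009 — 4 statements merged into one kernel-verified Lean document; each statement's English description precedes it below -/
import Mathlib

section
/- Let T > 0 and let u : ℝ³ × (0,T) → ℝ³ be measurable with ∫₀ᵀ∫_K |u(x,t)|² dx dt < ∞ for every compact set K ⊂ ℝ³. If ∫₀ᵀ∫_{B₁(x₀)} |u(x,t)|² dx dt → 0 as ‖x₀‖ → ∞, then sup_{x₀∈ℝ³} R⁻³ ∫₀ᵀ∫_{B_R(x₀)} |u(x,t)|² dx dt → 0 as R → ∞. -/
open MeasureTheory Metric Filter

/-- Averaging inequality (Tonelli). -/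
lemma avg_key (μ : Measure (EuclideanSpace ℝ (Fin 3))) [SFinite μ]
    (x₀ : EuclideanSpace ℝ (Fin 3)) (R : ℝ) :
    volume (ball (0 : EuclideanSpace ℝ (Fin 3)) 1) * μ (ball x₀ R) ≤
      ∫⁻ x in ball x₀ (R + 1), μ (ball x 1) := by
  set S : Set (EuclideanSpace ℝ (Fin 3) × EuclideanSpace ℝ (Fin 3)) :=
    {p | dist p.2 p.1 < 1} with hS
  have hSm : MeasurableSet S :=
    (isOpen_lt (by fun_prop) (by fun_prop)).measurableSet
  have h1 : ∀ x, μ (ball x 1) = ∫⁻ y, S.indicator 1 (x, y) ∂μ := by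
    intro x
    rw [← lintegral_indicator_one measurableSet_ball]
    rfl
  simp_rw [h1]
  rw [lintegral_lintegral_swap
    (f := fun x y => S.indicator (1 : EuclideanSpace ℝ (Fin 3) × EuclideanSpace ℝ (Fin 3) → ENNReal) (x, y))
    ((measurable_one.indicator hSm).aemeasurable)]
  calc volume (ball (0 : EuclideanSpace ℝ (Fin 3)) 1) * μ (ball x₀ R)
      = ∫⁻ y in ball x₀ R, volume (ball (0 : EuclideanSpace ℝ (Fin 3)) 1) ∂μ := by
        rw [setLIntegral_const]
    _ ≤ ∫⁻ y in ball x₀ R,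
        (∫⁻ x in ball x₀ (R + 1), S.indicator (1 : EuclideanSpace ℝ (Fin 3) × EuclideanSpace ℝ (Fin 3) → ENNReal) (x, y)) ∂μ := by
        apply setLIntegral_mono' measurableSet_ball
        intro y hy
        have h2 : ∀ x, S.indicator (1 : EuclideanSpace ℝ (Fin 3) × EuclideanSpace ℝ (Fin 3) → ENNReal) (x, y) = (ball y 1).indicator 1 x := by
          intro x
          by_cases h : dist x y < 1
          · rw [Set.indicator_of_mem (by simpa [hS, dist_comm] using h),
              Set.indicator_of_mem (by simpa using h)]
            rfl
          · rw [Set.indicator_of_notMem (by simpa [hS, dist_comm] using h),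
              Set.indicator_of_notMem (by simpa using h)]
        simp_rw [h2]
        rw [lintegral_indicator_one measurableSet_ball,
          Measure.restrict_apply measurableSet_ball,
          Set.inter_eq_left.2, ← Measure.addHaar_ball_center volume y 1]
        apply ball_subset_ball'
        have := mem_ball.1 hy
        linarith
    _ ≤ _ := setLIntegral_le_lintegral _ _

/-- If the unit-scale local energy of `u` over the time interval `(0,T)` tends to
`0` as the center `x₀` goes to infinity (along the cocompact filter), then the
uniformly-local averaged energy `sup_{x₀} R⁻³ ∫₀ᵀ∫_{B_R(x₀)} |u|²` tends to `0` as `R → ∞`. -/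
theorem statement0
    (T : ℝ) (hT : 0 < T)
    (u : EuclideanSpace ℝ (Fin 3) × ℝ → EuclideanSpace ℝ (Fin 3))
    (hu : Measurable u)
    (hloc : ∀ K : Set (EuclideanSpace ℝ (Fin 3)), IsCompact K →
      IntegrableOn (fun z => ‖u z‖ ^ 2) (K ×ˢ Set.Ioo 0 T))
    (hdecay : Tendsto
      (fun x₀ : EuclideanSpace ℝ (Fin 3) =>
        ∫ z in (ball x₀ 1) ×ˢ Set.Ioo 0 T, ‖u z‖ ^ 2)
      (cocompact (EuclideanSpace ℝ (Fin 3))) (nhds 0)) :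
    ∀ ε > 0, ∃ R₀ : ℝ, ∀ R ≥ R₀, ∀ x₀ : EuclideanSpace ℝ (Fin 3),
      R⁻¹ ^ 3 * ∫ z in (ball x₀ R) ×ˢ Set.Ioo 0 T, ‖u z‖ ^ 2 < ε := by
  intro ε hε
  set I : EuclideanSpace ℝ (Fin 3) → ℝ → ℝ :=
    fun x r => ∫ z in (ball x r) ×ˢ Set.Ioo 0 T, ‖u z‖ ^ 2 with hI
  have hI0 : ∀ x r, 0 ≤ I x r := fun x r => integral_nonneg (fun z => by positivity)
  set μ : Measure (EuclideanSpace ℝ (Fin 3)) :=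
    (((volume : Measure (EuclideanSpace ℝ (Fin 3) × ℝ)).restrict
      (Set.univ ×ˢ Set.Ioo 0 T)).withDensity
        (fun z => ENNReal.ofReal (‖u z‖ ^ 2))).map Prod.fst with hμ
  have hμb : ∀ x r, μ (ball x r) = ENNReal.ofReal (I x r) := by
    intro x r
    have hint : IntegrableOn (fun z => ‖u z‖ ^ 2) (ball x r ×ˢ Set.Ioo 0 T) :=
      (hloc _ (isCompact_closedBall x r)).mono_set
        (Set.prod_mono ball_subset_closedBall subset_rfl)
    rw [hμ, Measure.map_apply measurable_fst measurableSet_ball,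
      withDensity_apply _ (measurable_fst measurableSet_ball),
      Measure.restrict_restrict (measurable_fst measurableSet_ball), hI]
    have : Prod.fst ⁻¹' ball x r ∩ Set.univ ×ˢ Set.Ioo 0 T = ball x r ×ˢ Set.Ioo 0 T := by
      ext z; simp
    rw [this]
    exact (ofReal_integral_eq_lintegral_ofReal hint
      (Eventually.of_forall fun z => by positivity)).symm
  have hev : ∀ᶠ x in cocompact (EuclideanSpace ℝ (Fin 3)), I x 1 < ε / 16 :=
    hdecay.eventually (gt_mem_nhds (by positivity))
  obtain ⟨M, hM⟩ : ∃ M : ℝ, ∀ x, x ∉ closedBall (0 : EuclideanSpace ℝ (Fin 3)) M →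
      I x 1 < ε / 16 := by
    obtain ⟨K, hK, hKs⟩ := mem_cocompact.1 hev
    obtain ⟨M, hM⟩ := hK.isBounded.subset_closedBall 0
    exact ⟨M, fun x hx => hKs (fun h => hx (hM h))⟩
  set C := I 0 (M + 1) with hC
  set v := (volume (ball (0 : EuclideanSpace ℝ (Fin 3)) 1)).toReal with hv
  have hvt : volume (ball (0 : EuclideanSpace ℝ (Fin 3)) 1) = ENNReal.ofReal v :=
    (ENNReal.ofReal_toReal measure_ball_lt_top.ne).symm
  have hv0 : 0 < v := ENNReal.toReal_pos (measure_ball_pos _ _ one_pos).ne' measure_ball_lt_top.ne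
  set V := (volume (closedBall (0 : EuclideanSpace ℝ (Fin 3)) M)).toReal with hV
  have hVt : volume (closedBall (0 : EuclideanSpace ℝ (Fin 3)) M) = ENNReal.ofReal V :=
    (ENNReal.ofReal_toReal measure_closedBall_lt_top.ne).symm
  have hV0 : 0 ≤ V := ENNReal.toReal_nonneg
  have hC0 : 0 ≤ C := hI0 _ _
  have hpt : ∀ x, μ (ball x 1) ≤ ENNReal.ofReal (ε / 16) +
      (closedBall (0 : EuclideanSpace ℝ (Fin 3)) M).indicator
        (fun _ => ENNReal.ofReal C) x := by
    intro x
    by_cases hx : x ∈ closedBall (0 : EuclideanSpace ℝ (Fin 3)) M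
    · rw [Set.indicator_of_mem hx, hC, ← hμb]
      refine le_trans (measure_mono (ball_subset_ball' ?_)) le_add_self
      have := mem_closedBall.1 hx
      linarith
    · rw [hμb]
      exact le_trans (ENNReal.ofReal_le_ofReal (hM x hx).le) le_self_add
  have hmain : ∀ R ≥ (1 : ℝ), ∀ x₀, v * I x₀ R ≤ ε / 16 * ((R + 1) ^ 3 * v) + C * V := by
    intro R hR x₀
    have h := avg_key μ x₀ R
    have h2 : ∫⁻ x in ball x₀ (R + 1), μ (ball x 1) ≤
        ENNReal.ofReal (ε / 16) * volume (ball x₀ (R + 1)) + ENNReal.ofReal C *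
          volume (closedBall (0 : EuclideanSpace ℝ (Fin 3)) M) := by
      refine (lintegral_mono hpt).trans ?_
      rw [lintegral_add_left measurable_const, setLIntegral_const]
      gcongr
      refine (setLIntegral_le_lintegral _ _).trans ?_
      rw [lintegral_indicator_const measurableSet_closedBall]
    have h3 := h.trans h2
    rw [Measure.addHaar_ball _ _ (by linarith : (0:ℝ) ≤ R + 1), hvt, hVt, hμb,
      finrank_euclideanSpace_fin, ← ENNReal.ofReal_mul (by positivity),
      ← ENNReal.ofReal_mul (by positivity), ← ENNReal.ofReal_mul (by positivity),
      ← ENNReal.ofReal_mul (by positivity),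
      ← ENNReal.ofReal_add (by positivity) (by positivity),
      ENNReal.ofReal_le_ofReal_iff (by positivity)] at h3
    exact h3
  refine ⟨1 + 2 * (C * V / v) / ε, fun R hR x₀ => ?_⟩
  have hK0 : 0 ≤ C * V / v := by positivity
  have hR1 : 1 ≤ R := le_trans (by simp; positivity) hR
  have hm := hmain R hR1 x₀
  change R⁻¹ ^ 3 * I x₀ R < ε
  set K := C * V / v with hK
  have hCV : C * V = K * v := by rw [hK]; field_simp
  have hm2 : I x₀ R ≤ ε / 16 * (R + 1) ^ 3 + K := by
    rw [hCV] at hm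
    refine le_of_mul_le_mul_left (hm.trans (le_of_eq ?_)) hv0
    ring
  have hKR : 2 * K < ε * R := by
    have : 2 * K / ε < R := by linarith
    rw [div_lt_iff₀ hε] at this
    linarith
  have hR3 : R ≤ R ^ 3 := le_self_pow₀ hR1 (by norm_num)
  have h8 : (R + 1) ^ 3 ≤ 8 * R ^ 3 := by
    have : (R + 1) ^ 3 ≤ (2 * R) ^ 3 := by gcongr; linarith
    linarith [mul_pow 2 R 3]
  rw [inv_pow, inv_mul_lt_iff₀ (by positivity)]
  nlinarith [mul_le_mul_of_nonneg_left h8 hε.le, mul_le_mul_of_nonneg_left hR3 hε.le]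
end

section
/- There exists a constant C > 0 such that for every measurable f : ℝ³ → ℝ with M := sup_{x₀∈ℝ³} ∫_{B₁(x₀)} |f(x)|² dx < ∞ and every R ≥ 1, one has ∫_{{y ∈ ℝ³ : ‖y‖ ≥ 2R}} ‖y‖⁻⁴ |f(y)|² dy ≤ C M / R. -/
open MeasureTheory Metric Filter

abbrev E3 := EuclideanSpace ℝ (Fin 3)

noncomputable def hfun (R : ℝ) (x : E3) : ENNReal :=
  {x : E3 | R ≤ ‖x‖}.indicator (fun x => ENNReal.ofReal (‖x‖⁻¹ ^ 4)) x

lemma meas_hfun (R : ℝ) : Measurable (hfun R) := by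
  unfold hfun
  exact Measurable.indicator (by fun_prop) (measurableSet_le measurable_const measurable_norm)

lemma hfun_one_fin : ∫⁻ x, hfun 1 x < ⊤ := by
  have h := integrable_one_add_norm (E := E3) (μ := volume) (r := 4) (by simp; norm_num)
  have h2 := (h.const_mul 16).lintegral_lt_top
  refine lt_of_le_of_lt (lintegral_mono fun x => ?_) h2
  unfold hfun
  by_cases hx : 1 ≤ ‖x‖
  · rw [Set.indicator_of_mem (by exact hx)]
    apply ENNReal.ofReal_le_ofReal
    rw [Real.rpow_neg (by positivity)]
    have : (1 + ‖x‖) ^ (4:ℝ) = (1 + ‖x‖) ^ 4 := by exact_mod_cast Real.rpow_natCast (1 + ‖x‖) 4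
    rw [this, inv_pow]
    have h3 : (1 + ‖x‖) ^ 4 ≤ (2 * ‖x‖) ^ 4 := by gcongr; linarith
    have hp : 0 < ‖x‖ := by linarith
    rw [← div_eq_mul_inv, inv_eq_one_div, div_le_div_iff₀ (by positivity) (by positivity)]
    nlinarith
  · rw [Set.indicator_of_notMem (by exact hx)]
    exact zero_le

lemma hfun_scale (R : ℝ) (hR : 1 ≤ R) :
    ∫⁻ x, hfun R x = ENNReal.ofReal R⁻¹ * ∫⁻ x, hfun 1 x := by
  have hR0 : 0 < R := by linarith
  have h1 : ∫⁻ x, hfun R x ∂(Measure.map (fun x : E3 => R • x) volume)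
      = ∫⁻ x, hfun R (R • x) := lintegral_map (meas_hfun R) (measurable_const_smul R)
  have h2 : ∀ x : E3, hfun R (R • x) = ENNReal.ofReal (R⁻¹ ^ 4) * hfun 1 x := by
    intro x
    have hn : ‖R • x‖ = R * ‖x‖ := by rw [norm_smul, Real.norm_of_nonneg hR0.le]
    unfold hfun
    by_cases hx : 1 ≤ ‖x‖
    · rw [Set.indicator_of_mem (by show R ≤ ‖R • x‖; rw [hn]; nlinarith),
        Set.indicator_of_mem (by exact hx), ← ENNReal.ofReal_mul (by positivity), hn, mul_inv,
        mul_pow]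
    · rw [Set.indicator_of_notMem (by show ¬ (R ≤ ‖R • x‖); rw [hn]; nlinarith),
        Set.indicator_of_notMem (by exact hx), mul_zero]
  have h3 := Measure.map_addHaar_smul (volume : Measure E3) hR0.ne'
  rw [show (fun x : E3 => R • x) = (R • ·) from rfl, h3, lintegral_smul_measure] at h1
  simp_rw [h2] at h1
  rw [lintegral_const_mul _ (meas_hfun 1)] at h1
  have h4 : Module.finrank ℝ E3 = 3 := by simp
  rw [h4, abs_of_pos (by positivity), smul_eq_mul] at h1
  calc ∫⁻ x, hfun R x
      = ENNReal.ofReal (R ^ 3) * (ENNReal.ofReal (R ^ 3)⁻¹ * ∫⁻ x, hfun R x) := by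
        rw [← mul_assoc, ← ENNReal.ofReal_mul (by positivity), mul_inv_cancel₀ (by positivity)]
        simp
    _ = _ := by
        rw [h1, ← mul_assoc, ← ENNReal.ofReal_mul (by positivity)]
        congr 2
        field_simp

/-- Pointwise comparison of the weights. -/
lemma hfun_cmp (R : ℝ) (hR : 1 ≤ R) (x y : E3) (hy : 2 * R ≤ ‖y‖) (hxy : dist x y < 1) :
    ENNReal.ofReal (‖y‖⁻¹ ^ 4) ≤ 16 * hfun R x := by
  rw [dist_eq_norm] at hxy
  have a := norm_sub_norm_le x y
  have b := norm_sub_norm_le y x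
  rw [norm_sub_rev] at b
  unfold hfun
  rw [Set.indicator_of_mem (by show R ≤ ‖x‖; linarith)]
  rw [show (16 : ENNReal) = ENNReal.ofReal 16 by simp, ← ENNReal.ofReal_mul (by norm_num)]
  apply ENNReal.ofReal_le_ofReal
  have hx0 : 0 < ‖x‖ := by linarith
  have hy0 : 0 < ‖y‖ := by linarith
  have : ‖y‖⁻¹ ≤ 2 * ‖x‖⁻¹ := by
    rw [← div_eq_mul_inv, inv_eq_one_div, div_le_div_iff₀ hy0 hx0]
    linarith
  calc ‖y‖⁻¹ ^ 4 ≤ (2 * ‖x‖⁻¹) ^ 4 := by gcongr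
    _ = _ := by ring

lemma key (g : E3 → ENNReal) (hg : Measurable g) (m : ENNReal)
    (hm : ∀ x₀ : E3, ∫⁻ x in ball x₀ 1, g x ≤ m) (R : ℝ) (hR : 1 ≤ R) :
    volume (ball (0 : E3) 1) * ∫⁻ y in {y : E3 | 2 * R ≤ ‖y‖}, ENNReal.ofReal (‖y‖⁻¹ ^ 4) * g y
      ≤ 16 * (∫⁻ x, hfun R x) * m := by
  have hA : MeasurableSet {y : E3 | 2 * R ≤ ‖y‖} :=
    measurableSet_le measurable_const measurable_norm
  have hh := meas_hfun R
  have hD : MeasurableSet {p : E3 × E3 | dist p.2 p.1 < 1} :=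
    measurableSet_lt (by fun_prop) measurable_const
  rw [← lintegral_const_mul _ (by fun_prop)]
  calc ∫⁻ y in {y : E3 | 2 * R ≤ ‖y‖},
        volume (ball (0 : E3) 1) * (ENNReal.ofReal (‖y‖⁻¹ ^ 4) * g y)
      ≤ ∫⁻ y in {y : E3 | 2 * R ≤ ‖y‖}, ∫⁻ x,
          {p : E3 × E3 | dist p.2 p.1 < 1}.indicator (fun p => 16 * hfun R p.2 * g p.1) (y, x) := by
        refine setLIntegral_mono' hA fun y hy => ?_
        rw [← Measure.addHaar_ball_center volume y 1, mul_comm, ← setLIntegral_const,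
          ← lintegral_indicator measurableSet_ball]
        refine lintegral_mono fun x => ?_
        by_cases hx : dist x y < 1
        · rw [Set.indicator_of_mem (by exact hx), Set.indicator_of_mem (by exact hx)]
          exact mul_le_mul_left (hfun_cmp R hR x y hy hx) _
        · rw [Set.indicator_of_notMem (by exact hx)]
          exact zero_le
    _ ≤ ∫⁻ y, ∫⁻ x,
          {p : E3 × E3 | dist p.2 p.1 < 1}.indicator (fun p => 16 * hfun R p.2 * g p.1) (y, x) :=
        setLIntegral_le_lintegral _ _
    _ = ∫⁻ x, ∫⁻ y,
          {p : E3 × E3 | dist p.2 p.1 < 1}.indicator (fun p => 16 * hfun R p.2 * g p.1) (y, x) := by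
        apply lintegral_lintegral_swap
        exact (Measurable.indicator (by fun_prop) hD).aemeasurable
    _ ≤ ∫⁻ x, 16 * hfun R x * m := by
        refine lintegral_mono fun x => ?_
        refine le_trans (le_of_eq ?_) (mul_le_mul_right (hm x) _)
        rw [← lintegral_const_mul _ hg, ← lintegral_indicator measurableSet_ball]
        refine lintegral_congr fun y => ?_
        by_cases hx : dist x y < 1
        · rw [Set.indicator_of_mem (by exact hx),
            Set.indicator_of_mem (by rw [mem_ball, dist_comm]; exact hx)]
        · rw [Set.indicator_of_notMem (by exact hx),
            Set.indicator_of_notMem (by rw [mem_ball, dist_comm]; exact hx)]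
    _ = _ := by
        rw [lintegral_mul_const _ (by fun_prop), lintegral_const_mul _ hh]

/-- a uniformly-local `L²` bound `M` at unit scale controls the weighted
far-field integral `∫_{‖y‖ ≥ 2R} ‖y‖⁻⁴ |f|²` by `C M / R` for all `R ≥ 1`. -/
theorem statement5 :
    ∃ C > (0 : ℝ), ∀ f : EuclideanSpace ℝ (Fin 3) → ℝ, Measurable f →
      ∀ M : ℝ,
        (∀ x₀ : EuclideanSpace ℝ (Fin 3),
          ∫⁻ x in ball x₀ 1, ENNReal.ofReal (f x ^ 2) ≤ ENNReal.ofReal M) →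
        ∀ R ≥ (1 : ℝ),
          ∫⁻ y in {y : EuclideanSpace ℝ (Fin 3) | 2 * R ≤ ‖y‖},
              ENNReal.ofReal (‖y‖⁻¹ ^ 4 * f y ^ 2)
            ≤ ENNReal.ofReal (C * M / R) := by
  have hv0 : volume (ball (0 : E3) 1) ≠ 0 := (measure_ball_pos _ _ one_pos).ne'
  have hvt : volume (ball (0 : E3) 1) ≠ ⊤ := measure_ball_lt_top.ne
  set v := volume (ball (0 : E3) 1) with hv
  set D : ENNReal := v⁻¹ * (16 * ∫⁻ x, hfun 1 x) with hDdef
  have hD : D ≠ ⊤ := ENNReal.mul_ne_top (ENNReal.inv_ne_top.2 hv0)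
    (ENNReal.mul_ne_top (by simp) hfun_one_fin.ne)
  refine ⟨D.toReal + 1, by positivity, fun f hf M hM R hR => ?_⟩
  have hR0 : 0 < R := by linarith
  have hk := key (fun y => ENNReal.ofReal (f y ^ 2)) (by fun_prop) _ hM R hR
  rw [hfun_scale R hR] at hk
  simp_rw [← ENNReal.ofReal_mul (show (0:ℝ) ≤ ‖_‖⁻¹ ^ 4 by positivity)] at hk
  set I := ∫⁻ y in {y : E3 | 2 * R ≤ ‖y‖}, ENNReal.ofReal (‖y‖⁻¹ ^ 4 * f y ^ 2)
  calc I = v⁻¹ * (v * I) := by rw [← mul_assoc, ENNReal.inv_mul_cancel hv0 hvt, one_mul]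
    _ ≤ v⁻¹ * (16 * (ENNReal.ofReal R⁻¹ * ∫⁻ x, hfun 1 x) * ENNReal.ofReal M) := by gcongr
    _ = D * ENNReal.ofReal R⁻¹ * ENNReal.ofReal M := by rw [hDdef]; ring
    _ ≤ ENNReal.ofReal (D.toReal + 1) * ENNReal.ofReal R⁻¹ * ENNReal.ofReal M := by
        gcongr
        rw [← ENNReal.ofReal_toReal hD]
        apply ENNReal.ofReal_le_ofReal
        rw [ENNReal.ofReal_toReal hD]
        linarith
    _ = _ := by
        rw [← ENNReal.ofReal_mul (by positivity), ← ENNReal.ofReal_mul (by positivity)]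
        congr 1
        ring
end

section
/- There exists a constant C > 0 such that for each pair of indices 1 ≤ i, j ≤ 3 and all points x, x₀, y ∈ ℝ³ with y ≠ x₀ and ‖x₀ − y‖ ≥ 2‖x − x₀‖, one has |K_{ij}(x − y) − K_{ij}(x₀ − y)| ≤ C ‖x − x₀‖ / ‖x₀ − y‖⁴. -/
open MeasureTheory Metric Filter

/-- The Calderón–Zygmund kernel `K_{ij}(y) = (−δ_{ij}‖y‖² + 3 y_i y_j)/(4π‖y‖⁵)`. -/
noncomputable def Kker (i j : Fin 3) (y : EuclideanSpace ℝ (Fin 3)) : ℝ :=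
  (-(if i = j then (1 : ℝ) else 0) * ‖y‖ ^ 2 + 3 * y i * y j) / (4 * Real.pi * ‖y‖ ^ 5)

/-- Hölder-type difference estimate for the kernel `K_{ij}` away from the
singularity: if `‖x₀ − y‖ ≥ 2‖x − x₀‖` then
`|K_{ij}(x−y) − K_{ij}(x₀−y)| ≤ C‖x − x₀‖/‖x₀ − y‖⁴`. -/
theorem statement10 :
    ∃ C > (0 : ℝ), ∀ i j : Fin 3, ∀ x x₀ y : EuclideanSpace ℝ (Fin 3),
      y ≠ x₀ → 2 * ‖x - x₀‖ ≤ ‖x₀ - y‖ →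
      |Kker i j (x - y) - Kker i j (x₀ - y)| ≤ C * ‖x - x₀‖ / ‖x₀ - y‖ ^ 4 := by
  refine ⟨4000, by norm_num, ?_⟩
  intro i j x x₀ y hy h
  have hv : 0 < ‖x₀ - y‖ := norm_pos_iff.mpr (sub_ne_zero.mpr hy.symm)
  have hw : x - x₀ = (x - y) - (x₀ - y) := by abel
  rw [hw] at h ⊢
  generalize x - y = u at *
  generalize x₀ - y = v at *
  have hui : |u i| ≤ ‖u‖ := by simpa using PiLp.norm_apply_le u i
  have hvi : |v i| ≤ ‖v‖ := by simpa using PiLp.norm_apply_le v i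
  have hvj : |v j| ≤ ‖v‖ := by simpa using PiLp.norm_apply_le v j
  have hdi : |u i - v i| ≤ ‖u - v‖ := by simpa using PiLp.norm_apply_le (u - v) i
  have hdj : |u j - v j| ≤ ‖u - v‖ := by simpa using PiLp.norm_apply_le (u - v) j
  have hn : |‖u‖ - ‖v‖| ≤ ‖u - v‖ := abs_norm_sub_norm_le u v
  have hd : 0 ≤ ‖u - v‖ := norm_nonneg _
  unfold Kker
  have he : |-(if i = j then (1 : ℝ) else 0)| ≤ 1 := by split_ifs <;> simp
  generalize -(if i = j then (1 : ℝ) else 0) = e at *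
  generalize u i = a at *
  generalize u j = b at *
  generalize v i = a' at *
  generalize v j = b' at *
  generalize ‖u - v‖ = d at *
  generalize ‖u‖ = s at *
  generalize ‖v‖ = r at *
  have hs1 : r / 2 ≤ s := by linarith [(abs_le.mp hn).1]
  have hs2 : s ≤ 3 / 2 * r := by linarith [(abs_le.mp hn).2]
  have hs : 0 < s := by linarith
  have hN : |e * r ^ 2 + 3 * a' * b'| ≤ 4 * r ^ 2 := by
    calc _ ≤ |e * r ^ 2| + |3 * a' * b'| := abs_add_le _ _
      _ = |e| * r ^ 2 + 3 * (|a'| * |b'|) := by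
        simp only [abs_mul, abs_pow, abs_of_pos hv]; norm_num; ring
      _ ≤ 1 * r ^ 2 + 3 * (r * r) := by gcongr
      _ = _ := by ring
  have hD : |(e * s ^ 2 + 3 * a * b) - (e * r ^ 2 + 3 * a' * b')| ≤ 10 * d * r := by
    calc _ = |e * ((s - r) * (s + r)) + 3 * (a * (b - b') + (a - a') * b')| := by
          congr 1; ring
      _ ≤ |e * ((s - r) * (s + r))| + |3 * (a * (b - b') + (a - a') * b')| := abs_add_le _ _
      _ = |e| * (|s - r| * (s + r)) + 3 * |a * (b - b') + (a - a') * b'| := by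
        simp only [abs_mul, abs_of_pos (add_pos hs hv)]; norm_num
      _ ≤ |e| * (|s - r| * (s + r)) + 3 * (|a| * |b - b'| + |a - a'| * |b'|) := by
        gcongr
        rw [← abs_mul, ← abs_mul]; exact abs_add_le _ _
      _ ≤ 1 * (d * (3 / 2 * r + r)) + 3 * (3 / 2 * r * d + d * r) := by
        gcongr
        linarith
      _ = _ := by ring
  have hP : |r ^ 5 - s ^ 5| ≤ 26 * d * r ^ 4 := by
    calc _ = |s - r| * (s ^ 4 + s ^ 3 * r + s ^ 2 * r ^ 2 + s * r ^ 3 + r ^ 4) := by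
          rw [abs_sub_comm, ← abs_of_pos (show 0 < s ^ 4 + s ^ 3 * r + s ^ 2 * r ^ 2 + s * r ^ 3 + r ^ 4 by positivity),
            ← abs_mul]
          congr 1; ring
      _ ≤ d * ((3 / 2 * r) ^ 4 + (3 / 2 * r) ^ 3 * r + (3 / 2 * r) ^ 2 * r ^ 2
            + (3 / 2 * r) * r ^ 3 + r ^ 4) := by gcongr
      _ = (211 / 16) * (d * r ^ 4) := by ring
      _ ≤ 26 * (d * r ^ 4) := by gcongr; norm_num
      _ = _ := by ring
  generalize e * s ^ 2 + 3 * a * b = M at *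
  generalize e * r ^ 2 + 3 * a' * b' = N at *
  have hpi := Real.pi_gt_three
  have hX : |M * r ^ 5 - N * s ^ 5| ≤ 114 * d * r ^ 6 := by
    calc _ = |(M - N) * r ^ 5 + N * (r ^ 5 - s ^ 5)| := by congr 1; ring
      _ ≤ |(M - N) * r ^ 5| + |N * (r ^ 5 - s ^ 5)| := abs_add_le _ _
      _ = |M - N| * r ^ 5 + |N| * |r ^ 5 - s ^ 5| := by
        simp only [abs_mul, abs_pow, abs_of_pos hv]
      _ ≤ (10 * d * r) * r ^ 5 + (4 * r ^ 2) * (26 * d * r ^ 4) := by gcongr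
      _ = _ := by ring
  have hE : M / (4 * Real.pi * s ^ 5) - N / (4 * Real.pi * r ^ 5)
      = (M * r ^ 5 - N * s ^ 5) / (4 * Real.pi * (s ^ 5 * r ^ 5)) := by
    field_simp
  rw [hE, abs_div, abs_of_pos (show 0 < 4 * Real.pi * (s ^ 5 * r ^ 5) by positivity)]
  calc _ ≤ (114 * d * r ^ 6) / (4 * 3 * ((r / 2) ^ 5 * r ^ 5)) := by gcongr
    _ = 304 * d / r ^ 4 := by field_simp; ring
    _ ≤ 4000 * d / r ^ 4 := by gcongr; norm_num
end

section
/- There exists a constant C > 0 such that for each pair of indices 1 ≤ i, j ≤ 3, every R > 0, every x₀ ∈ ℝ³, and every x ∈ B_R(x₀), one has ∫_{{y ∈ ℝ³ : ‖x₀ − y‖ ≥ 2R}} |K_{ij}(x − y) − K_{ij}(x₀ − y)| dy ≤ C. Consequently, for every bounded measurable f : ℝ³ → ℝ, the function y ↦ (K_{ij}(x − y) − K_{ij}(x₀ − y)) f(y) is Lebesgue integrable over {y : ‖x₀ − y‖ ≥ 2R} and the absolute value of its integral is at most C ‖f‖_{L^∞}. -/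
open MeasureTheory Metric Filter

lemma aux_kdiff (d h a1 a2 b1 b2 p q : ℝ) (hd : |d| ≤ 1) (hp : 0 < p) (hq : 0 < q)
    (hpq : |p - q| ≤ h) (h2 : q ≤ 2 * p) (ha1 : |a1| ≤ p) (ha2 : |a2| ≤ p)
    (hb1 : |b1| ≤ q) (hb2 : |b2| ≤ q) (h1 : |a1 - b1| ≤ h) (h3 : |a2 - b2| ≤ h) :
    |(-d * p ^ 2 + 3 * a1 * a2) / (4 * Real.pi * p ^ 5)
      - (-d * q ^ 2 + 3 * b1 * b2) / (4 * Real.pi * q ^ 5)| ≤ 248 * (h * (q⁻¹) ^ 4) := by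
  have hh : 0 ≤ h := (abs_nonneg _).trans hpq
  obtain ⟨u, hu⟩ : ∃ u, u = p⁻¹ := ⟨_, rfl⟩
  obtain ⟨v, hv⟩ : ∃ v, v = q⁻¹ := ⟨_, rfl⟩
  have hu0 : 0 < u := by rw [hu]; positivity
  have hv0 : 0 < v := by rw [hv]; positivity
  have hpu : p * u = 1 := by rw [hu]; exact mul_inv_cancel₀ hp.ne'
  have hqv : q * v = 1 := by rw [hv]; exact mul_inv_cancel₀ hq.ne'
  have huv : u ≤ 2 * v := by
    have := mul_le_mul_of_nonneg_right h2 (mul_pos hu0 hv0).le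
    calc u = q * (u * v) := by linear_combination (-u) * hqv
      _ ≤ _ := this
      _ = 2 * v := by linear_combination (2 * v) * hpu
  have hd1 : |u - v| ≤ 2 * h * v ^ 2 := by
    have : u - v = -(p - q) * (u * v) := by linear_combination (-u) * hqv + v * hpu
    rw [this, abs_mul, abs_neg, abs_of_pos (mul_pos hu0 hv0)]
    calc _ ≤ h * (2 * v * v) := by gcongr
      _ = _ := by ring
  have hu3 : u ^ 3 ≤ 8 * v ^ 3 := by
    calc u ^ 3 ≤ (2 * v) ^ 3 := by gcongr
      _ = _ := by ring
  have hd3 : |u ^ 3 - v ^ 3| ≤ 14 * (h * v ^ 4) := by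
    have : u ^ 3 - v ^ 3 = (u - v) * (u ^ 2 + u * v + v ^ 2) := by ring
    rw [this, abs_mul, abs_of_pos (by positivity : 0 < u ^ 2 + u * v + v ^ 2)]
    calc _ ≤ (2 * h * v ^ 2) * ((2 * v) ^ 2 + (2 * v) * v + v ^ 2) := by gcongr
      _ = _ := by ring
  have key1 : ∀ a, |a| ≤ p → |a * u| ≤ 1 := fun a ha => by
    rw [abs_mul, abs_of_pos hu0, ← hpu]; gcongr
  have key2 : ∀ a, |a| ≤ q → |a * v| ≤ 1 := fun a ha => by
    rw [abs_mul, abs_of_pos hv0, ← hqv]; gcongr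
  have key3 : ∀ a b, |b| ≤ q → |a - b| ≤ h → |a * u - b * v| ≤ 4 * h * v := fun a b hb hab => by
    have : a * u - b * v = (a - b) * u + b * (u - v) := by ring
    rw [this]
    calc _ ≤ |(a - b) * u| + |b * (u - v)| := abs_add_le _ _
      _ = |a - b| * u + |b| * |u - v| := by rw [abs_mul, abs_mul, abs_of_pos hu0]
      _ ≤ h * (2 * v) + q * (2 * h * v ^ 2) := by gcongr
      _ = _ := by linear_combination (2 * h * v) * hqv
  have e1 := key1 a1 ha1
  have e2 := key1 a2 ha2
  have e3 := key2 b1 hb1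
  have e4 := key2 b2 hb2
  have e5 := key3 a1 b1 hb1 h1
  have e6 := key3 a2 b2 hb2 h3
  have hP : |(a1 * u) * (a2 * u) * u ^ 3 - (b1 * v) * (b2 * v) * v ^ 3| ≤ 78 * (h * v ^ 4) := by
    have : (a1 * u) * (a2 * u) * u ^ 3 - (b1 * v) * (b2 * v) * v ^ 3
      = (a1 * u - b1 * v) * (a2 * u) * u ^ 3 + (b1 * v) * (a2 * u - b2 * v) * u ^ 3
        + (b1 * v) * (b2 * v) * (u ^ 3 - v ^ 3) := by ring
    rw [this]
    refine (abs_add_three _ _ _).trans ?_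
    rw [abs_mul, abs_mul, abs_mul (b1 * v * (a2 * u - b2 * v)), abs_mul (b1 * v),
      abs_mul (b1 * v * (b2 * v)), abs_mul (b1 * v) (b2 * v), abs_of_pos (pow_pos hu0 3)]
    calc _ ≤ (4 * h * v) * 1 * (8 * v ^ 3) + 1 * (4 * h * v) * (8 * v ^ 3)
          + 1 * 1 * (14 * (h * v ^ 4)) := by gcongr
      _ = _ := by ring
  have hpi : (4 * Real.pi)⁻¹ ≤ 1 := by
    apply inv_le_one_of_one_le₀; linarith [Real.pi_gt_three]
  have hE : (-d * p ^ 2 + 3 * a1 * a2) / (4 * Real.pi * p ^ 5)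
      - (-d * q ^ 2 + 3 * b1 * b2) / (4 * Real.pi * q ^ 5)
      = (4 * Real.pi)⁻¹ * (-d * (u ^ 3 - v ^ 3)
        + 3 * ((a1 * u) * (a2 * u) * u ^ 3 - (b1 * v) * (b2 * v) * v ^ 3)) := by
    have := Real.pi_pos
    rw [hu, hv]; field_simp; ring
  rw [hE, ← hv, abs_mul, abs_of_pos (by have := Real.pi_pos; positivity)]
  have hin : |-d * (u ^ 3 - v ^ 3)
        + 3 * ((a1 * u) * (a2 * u) * u ^ 3 - (b1 * v) * (b2 * v) * v ^ 3)| ≤ 248 * (h * v ^ 4) := by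
    refine (abs_add_le _ _).trans ?_
    rw [abs_mul, abs_neg, abs_mul 3, abs_of_pos (three_pos : (0:ℝ) < 3)]
    calc _ ≤ 1 * (14 * (h * v ^ 4)) + 3 * (78 * (h * v ^ 4)) := by gcongr
      _ = _ := by ring
  calc _ ≤ 1 * (248 * (h * v ^ 4)) := by gcongr
    _ = _ := by ring

lemma aux_pointwise (i j : Fin 3) (R : ℝ) (hR : 0 < R) (x₀ x y : EuclideanSpace ℝ (Fin 3))
    (hx : x ∈ ball x₀ R) (hy : 2 * R ≤ ‖x₀ - y‖) :
    |Kker i j (x - y) - Kker i j (x₀ - y)|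
      ≤ 1500 * ((R ^ 3)⁻¹ * (1 + ‖R⁻¹ • (x₀ - y)‖) ^ (-4 : ℝ)) := by
  have hab : ‖(x - y) - (x₀ - y)‖ ≤ R := by
    rw [sub_sub_sub_cancel_right]; exact (mem_ball_iff_norm.1 hx).le
  have hpq := (abs_norm_sub_norm_le (x - y) (x₀ - y)).trans hab
  have hco : ∀ (z : EuclideanSpace ℝ (Fin 3)) k, |z k| ≤ ‖z‖ := fun z k => by
    simpa using PiLp.norm_apply_le z k
  have hq : 0 < ‖x₀ - y‖ := by linarith
  have h2 := (abs_le.1 hpq).1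
  have := aux_kdiff (if i = j then (1 : ℝ) else 0) R ((x - y) i) ((x - y) j) ((x₀ - y) i)
    ((x₀ - y) j) ‖x - y‖ ‖x₀ - y‖ (by split_ifs <;> simp) (by linarith) hq hpq (by linarith)
    (hco _ _) (hco _ _) (hco _ _) (hco _ _) ((hco (x - y - (x₀ - y)) i).trans hab)
    ((hco (x - y - (x₀ - y)) j).trans hab)
  refine this.trans ?_
  rw [norm_smul, Real.norm_of_nonneg (by positivity),
    show (-4 : ℝ) = -((4 : ℕ) : ℝ) by norm_num, Real.rpow_neg (by positivity), Real.rpow_natCast]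
  generalize ‖x₀ - y‖ = q at *
  have h5 : q⁻¹ ≤ (3 / 2) * (R + q)⁻¹ := by
    rw [← div_eq_mul_inv, le_div_iff₀ (by positivity), inv_mul_le_iff₀ hq]; linarith
  have h6 : (R ^ 3)⁻¹ * ((1 + R⁻¹ * q) ^ 4)⁻¹ = R * ((R + q)⁻¹) ^ 4 := by
    have : 1 + R⁻¹ * q = (R + q) / R := by field_simp
    rw [this]; field_simp
  rw [h6]
  calc 248 * (R * q⁻¹ ^ 4) ≤ 248 * (R * ((3 / 2) * (R + q)⁻¹) ^ 4) := by gcongr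
    _ = (248 * 81 / 16) * (R * ((R + q)⁻¹) ^ 4) := by ring
    _ ≤ _ := by gcongr; norm_num

lemma aux_meas (i j : Fin 3) : Measurable (Kker i j) := by
  unfold Kker
  fun_prop

/-- uniform integrability of the far-field kernel difference: for `x ∈ B_R(x₀)`,
`∫_{‖x₀−y‖ ≥ 2R} |K_{ij}(x−y) − K_{ij}(x₀−y)| dy ≤ C`, and consequently for every bounded
measurable `f` (with pointwise bound `M`) the far-field integrand is integrable with integral
bounded by `C M`. -/
theorem statement11 :
    ∃ C > (0 : ℝ), ∀ i j : Fin 3, ∀ R : ℝ, 0 < R →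
      ∀ x₀ x : EuclideanSpace ℝ (Fin 3), x ∈ ball x₀ R →
        (∫⁻ y in {y : EuclideanSpace ℝ (Fin 3) | 2 * R ≤ ‖x₀ - y‖},
            ENNReal.ofReal |Kker i j (x - y) - Kker i j (x₀ - y)|
          ≤ ENNReal.ofReal C) ∧
        ∀ f : EuclideanSpace ℝ (Fin 3) → ℝ, Measurable f →
          ∀ M : ℝ, (∀ y, |f y| ≤ M) →
            IntegrableOn
              (fun y => (Kker i j (x - y) - Kker i j (x₀ - y)) * f y)
              {y : EuclideanSpace ℝ (Fin 3) | 2 * R ≤ ‖x₀ - y‖} ∧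
            |∫ y in {y : EuclideanSpace ℝ (Fin 3) | 2 * R ≤ ‖x₀ - y‖},
                (Kker i j (x - y) - Kker i j (x₀ - y)) * f y| ≤ C * M := by
  have hg : Integrable (fun z : EuclideanSpace ℝ (Fin 3) => (1 + ‖z‖) ^ (-4 : ℝ)) :=
    integrable_one_add_norm (by simp; norm_num)
  set g : EuclideanSpace ℝ (Fin 3) → ℝ := fun z => (1 + ‖z‖) ^ (-4 : ℝ) with hgdef
  have hg0 : ∀ z, 0 ≤ g z := fun z => by simp only [hgdef]; positivity
  have hJ : 0 ≤ ∫ z, g z := integral_nonneg hg0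
  refine ⟨1500 * (∫ z, g z) + 1, by positivity, ?_⟩
  intro i j R hR x₀ x hx
  set S := {y : EuclideanSpace ℝ (Fin 3) | 2 * R ≤ ‖x₀ - y‖} with hS
  have hSm : MeasurableSet S := measurableSet_le (by fun_prop) (by fun_prop)
  set G : EuclideanSpace ℝ (Fin 3) → ℝ :=
    fun y => 1500 * ((R ^ 3)⁻¹ * g (R⁻¹ • (x₀ - y))) with hG
  have hG0 : ∀ y, 0 ≤ G y := fun y => by
    have := hg0 (R⁻¹ • (x₀ - y))
    simp only [hG]; positivity
  have hGi : Integrable G :=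
    (((hg.comp_smul (inv_ne_zero hR.ne')).comp_sub_left x₀).const_mul _).const_mul _
  have hGint : ∫ y, G y = 1500 * ∫ z, g z := by
    simp only [hG]
    rw [integral_const_mul, integral_const_mul,
      integral_sub_left_eq_self (fun y => g (R⁻¹ • y)) volume x₀, Measure.integral_comp_smul]
    simp only [finrank_euclideanSpace, Fintype.card_fin, smul_eq_mul, inv_pow, inv_inv]
    rw [abs_of_pos (by positivity)]
    field_simp
  have hpt : ∀ y ∈ S, |Kker i j (x - y) - Kker i j (x₀ - y)| ≤ G y := fun y hy =>
    aux_pointwise i j R hR x₀ x y hx hy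
  have hDm : Measurable (fun y => Kker i j (x - y) - Kker i j (x₀ - y)) :=
    ((aux_meas i j).comp (by fun_prop)).sub ((aux_meas i j).comp (by fun_prop))
  have hGS : ∫ y in S, G y ≤ ∫ y, G y :=
    setIntegral_le_integral hGi (Filter.Eventually.of_forall hG0)
  refine ⟨?_, ?_⟩
  · calc _ ≤ ∫⁻ y in S, ENNReal.ofReal (G y) :=
          setLIntegral_mono' hSm fun y hy => ENNReal.ofReal_le_ofReal (hpt y hy)
      _ = ENNReal.ofReal (∫ y in S, G y) :=
          (ofReal_integral_eq_lintegral_ofReal hGi.integrableOn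
            (Filter.Eventually.of_forall hG0)).symm
      _ ≤ _ := ENNReal.ofReal_le_ofReal (by linarith)
  · intro f hf M hM
    have hM0 : 0 ≤ M := (abs_nonneg _).trans (hM 0)
    have hb : ∀ᵐ y ∂(volume.restrict S),
        ‖(Kker i j (x - y) - Kker i j (x₀ - y)) * f y‖ ≤ G y * M := by
      refine (ae_restrict_iff' hSm).2 (Filter.Eventually.of_forall fun y hy => ?_)
      rw [norm_mul, Real.norm_eq_abs, Real.norm_eq_abs]
      exact mul_le_mul (hpt y hy) (hM y) (abs_nonneg _) (hG0 y)
    have hGM : Integrable (fun y => G y * M) (volume.restrict S) :=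
      hGi.integrableOn.mul_const M
    refine ⟨hGM.mono' (hDm.mul hf).aestronglyMeasurable hb, ?_⟩
    have := norm_integral_le_of_norm_le hGM hb
    rw [Real.norm_eq_abs, integral_mul_const] at this
    exact this.trans (mul_le_mul_of_nonneg_right (by linarith) hM0)
end
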